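/- Let A be an m×n real matrix, b ∈ ℝᵐ, π : {1,…,n} → {1,…,K} a block structure on ℝⁿ, α, β ∈ ℝᴷ with αₖ ≥ 0 and βₖ ≥ 0 for all k, and M > 0. Define the primal objective P(x) = Σₖ [ αₖ · 𝟙(block k of x contains a nonzero entry) + βₖ · #{i : π(i)=k and xᵢ ≠ 0} ] and the bidual objective B(x) = (1/M) · Σₖ [ αₖ · max_{i:π(i)=k} |xᵢ| + βₖ · Σ_{i:π(i)=k} |xᵢ| ]. Let S = {x ∈ ℝⁿ : Ax = b and ‖x‖∞ ≤ M}. If x_p is a minimizer of P over S and x_b is a minimizer of B over S, then B(x_b) ≤ P(x_p). (The optimal value of the Lagrangian bidual relaxation is a lower bound on the optimal value of the NP-hard primal mixed-sparsity problem.) -/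

import Mathlib

open Finset
attribute [local instance] Classical.propDecidable

/-- ℓ1 norm of a vector. -/
noncomputable def l1norm {n : ℕ} (x : Fin n → ℝ) : ℝ := ∑ i, |x i|

/-- ℓ0 "norm": number of nonzero entries. -/
noncomputable def l0norm {n : ℕ} (x : Fin n → ℝ) : ℕ :=
  (Finset.univ.filter (fun i => x i ≠ 0)).card

/-- Max of |x i| over block k (empty block contributes 0). -/
noncomputable def blockMax {n K : ℕ} (π : Fin n → Fin K) (x : Fin n → ℝ) (k : Fin K) : ℝ :=
  (Finset.univ.filter (fun i => π i = k)).fold max 0 (fun i => |x i|)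

/-- Sum of |x i| over block k. -/
noncomputable def blockSum {n K : ℕ} (π : Fin n → Fin K) (x : Fin n → ℝ) (k : Fin K) : ℝ :=
  ∑ i ∈ Finset.univ.filter (fun i => π i = k), |x i|

/-- Number of nonzero entries of x in block k. -/
noncomputable def blockL0 {n K : ℕ} (π : Fin n → Fin K) (x : Fin n → ℝ) (k : Fin K) : ℕ :=
  (Finset.univ.filter (fun i => π i = k ∧ x i ≠ 0)).card

/-- Group sparsity: number of blocks containing a nonzero entry. -/
noncomputable def l0grp {n K : ℕ} (π : Fin n → Fin K) (x : Fin n → ℝ) : ℕ :=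
  (Finset.univ.filter (fun k => ∃ i, π i = k ∧ x i ≠ 0)).card

/-- ℓ_{1,∞} group norm. -/
noncomputable def l1inf {n K : ℕ} (π : Fin n → Fin K) (x : Fin n → ℝ) : ℝ :=
  ∑ k, blockMax π x k

/-- Mixed primal objective. -/
noncomputable def primalObj {n K : ℕ} (π : Fin n → Fin K) (α β : Fin K → ℝ) (x : Fin n → ℝ) : ℝ :=
  ∑ k, (α k * (if ∃ i, π i = k ∧ x i ≠ 0 then (1 : ℝ) else 0) + β k * (blockL0 π x k : ℝ))

/-- Mixed bidual objective. -/
noncomputable def bidualObj {n K : ℕ} (π : Fin n → Fin K) (α β : Fin K → ℝ) (M : ℝ)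
    (x : Fin n → ℝ) : ℝ :=
  (1 / M) * ∑ k, (α k * blockMax π x k + β k * blockSum π x k)

theorem blockMax_le_mul_indicator {n K : ℕ} (π : Fin n → Fin K) {M : ℝ} (hM : 0 ≤ M)
    {x : Fin n → ℝ} (hx : ∀ i, |x i| ≤ M) (k : Fin K) :
    blockMax π x k ≤ M * (if ∃ i, π i = k ∧ x i ≠ 0 then (1 : ℝ) else 0) := by
  refine (Finset.fold_max_le _).2 ⟨by split_ifs <;> simp [hM], fun i hi => ?_⟩
  have hik : π i = k := (Finset.mem_filter.1 hi).2
  split_ifs with h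
  · simpa using hx i
  · have hxi : x i = 0 := by
      by_contra hne
      exact h ⟨i, hik, hne⟩
    simp [hxi]

theorem blockSum_le_mul_blockL0 {n K : ℕ} (π : Fin n → Fin K) {M : ℝ}
    {x : Fin n → ℝ} (hx : ∀ i, |x i| ≤ M) (k : Fin K) :
    blockSum π x k ≤ M * (blockL0 π x k : ℝ) := by
  have hsum : blockSum π x k = ∑ i with π i = k ∧ x i ≠ 0, |x i| := by
    rw [blockSum, ← Finset.filter_filter]
    exact (Finset.sum_filter_of_ne fun i _ hi => abs_ne_zero.1 hi).symm
  rw [hsum, blockL0, mul_comm, ← nsmul_eq_mul]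
  exact Finset.sum_le_card_nsmul _ _ _ fun i _ => hx i

/-- On the box `‖x‖∞ ≤ M` the bidual objective minorizes the primal objective. -/
theorem bidualObj_le_primalObj {n K : ℕ} (π : Fin n → Fin K) {α β : Fin K → ℝ}
    (hα : ∀ k, 0 ≤ α k) (hβ : ∀ k, 0 ≤ β k) {M : ℝ} (hM : 0 < M)
    {x : Fin n → ℝ} (hx : ∀ i, |x i| ≤ M) :
    bidualObj π α β M x ≤ primalObj π α β x := by
  rw [bidualObj, primalObj, one_div, inv_mul_le_iff₀ hM, Finset.mul_sum]
  refine Finset.sum_le_sum fun k _ => ?_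
  rw [mul_add, mul_left_comm M (α k), mul_left_comm M (β k)]
  exact add_le_add
    (mul_le_mul_of_nonneg_left (blockMax_le_mul_indicator π hM.le hx k) (hα k))
    (mul_le_mul_of_nonneg_left (blockSum_le_mul_blockL0 π hx k) (hβ k))

/-- the optimal bidual value is a lower bound on the optimal primal value. -/
theorem bidual_opt_le_primal_opt {m n K : ℕ} (A : Matrix (Fin m) (Fin n) ℝ) (b : Fin m → ℝ)
    (π : Fin n → Fin K) (α β : Fin K → ℝ)
    (hα : ∀ k, 0 ≤ α k) (hβ : ∀ k, 0 ≤ β k) (M : ℝ) (hM : 0 < M)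
    (xp : Fin n → ℝ) (hxpfeas : A.mulVec xp = b ∧ ∀ i, |xp i| ≤ M)
    (hxpmin : ∀ y : Fin n → ℝ, (A.mulVec y = b ∧ ∀ i, |y i| ≤ M) →
      primalObj π α β xp ≤ primalObj π α β y)
    (xb : Fin n → ℝ) (hxbfeas : A.mulVec xb = b ∧ ∀ i, |xb i| ≤ M)
    (hxbmin : ∀ y : Fin n → ℝ, (A.mulVec y = b ∧ ∀ i, |y i| ≤ M) →
      bidualObj π α β M xb ≤ bidualObj π α β M y) :
    bidualObj π α β M xb ≤ primalObj π α β xp := by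
  exact (hxbmin xp hxpfeas).trans (bidualObj_le_primalObj π hα hβ hM hxpfeas.2)
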